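/- Let x ∈ ℒ_n have an orbit A·x with compact closure and let ε ∈ (0,1). Then the sets U_k^{x,ε}, 1 ≤ k ≤ n, form an open cover of A, and this cover has positive inradius: there exists r > 0 such that for every a ∈ A there is some k with B_r(a) ⊆ U_k^{x,ε}, where B_r(a) is the r-ball around a in the metric on A obtained by identifying a ∈ A with (log a₁₁,…,log a_nn) in the trace-zero hyperplane of ℝⁿ with its Euclidean metric. -/

import Mathlib

open scoped BigOperators
open Matrix Topology Filter

noncomputable section

namespace SW

/-! ### Euclidean structure on `Fin n → ℝ` -/

/-- The standard Euclidean inner product on `Fin n → ℝ`. -/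
def einner {n : ℕ} (v w : Fin n → ℝ) : ℝ := ∑ i, v i * w i

/-- The Euclidean norm on `Fin n → ℝ`. -/
def enorm {n : ℕ} (v : Fin n → ℝ) : ℝ := Real.sqrt (∑ i, v i ^ 2)

lemma einner_add_left {n : ℕ} (u v w : Fin n → ℝ) :
    einner (u + v) w = einner u w + einner v w := by
  simp [einner, add_mul, Finset.sum_add_distrib]

lemma einner_neg_left {n : ℕ} (u w : Fin n → ℝ) : einner (-u) w = -einner u w := by
  simp [einner]

lemma einner_smul_left {n : ℕ} (c : ℝ) (u w : Fin n → ℝ) :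
    einner (c • u) w = c * einner u w := by
  simp [einner, Finset.mul_sum, mul_assoc]

/-! ### Covolume, rank, lattices, stability -/

/-- `√(det Gram)` of a finite family of vectors: the covolume of the ℤ-span of the family
(in the span of the family) when the family is linearly independent. -/
def gvol {n r : ℕ} (v : Fin r → (Fin n → ℝ)) : ℝ :=
  Real.sqrt (Matrix.det (Matrix.of fun i j => einner (v i) (v j)))

/-- `c` is the covolume of `Λ` in its real span, as computed from some ℤ-basis of `Λ` which is
linearly independent over `ℝ`. -/
def covolSpec {n : ℕ} (Λ : AddSubgroup (Fin n → ℝ)) (c : ℝ) : Prop :=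
  ∃ (r : ℕ) (v : Fin r → (Fin n → ℝ)), LinearIndependent ℝ v ∧
    Λ = AddSubgroup.closure (Set.range v) ∧ c = gvol v

/-- The covolume of a discrete subgroup `Λ ⊆ ℝⁿ` inside its real span (with `covol ⊥ = 1`). -/
def covol {n : ℕ} (Λ : AddSubgroup (Fin n → ℝ)) : ℝ := sInf {c | covolSpec Λ c}

/-- The rank of a discrete subgroup of `ℝⁿ`: the dimension of its real span. -/
def rk {n : ℕ} (Λ : AddSubgroup (Fin n → ℝ)) : ℕ :=
  Module.finrank ℝ (Submodule.span ℝ (Λ : Set (Fin n → ℝ)))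

/-- A lattice in `ℝⁿ`: a discrete subgroup spanning `ℝⁿ` (equivalently, cocompact). -/
def IsLattice {n : ℕ} (L : AddSubgroup (Fin n → ℝ)) : Prop :=
  DiscreteTopology ↥L ∧ Submodule.span ℝ (L : Set (Fin n → ℝ)) = ⊤

/-- A unimodular lattice: a lattice of covolume one. -/
def IsUnimodularLattice {n : ℕ} (L : AddSubgroup (Fin n → ℝ)) : Prop :=
  IsLattice L ∧ covol L = 1

/-- A stable lattice: a unimodular lattice all of whose subgroups have covolume at least one. -/
def IsStable {n : ℕ} (L : AddSubgroup (Fin n → ℝ)) : Prop :=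
  IsUnimodularLattice L ∧ ∀ Λ : AddSubgroup (Fin n → ℝ), Λ ≤ L → 1 ≤ covol Λ

/-! ### Matrices: the diagonal group `A`, `SL_n(ℤ)`, lattices from matrices -/

/-- The group `A` of positive diagonal matrices of determinant one (as a set of matrices). -/
def Apos (n : ℕ) : Set (Matrix (Fin n) (Fin n) ℝ) :=
  {a | ∃ d : Fin n → ℝ, (∀ i, 0 < d i) ∧ (∏ i, d i) = 1 ∧ a = Matrix.diagonal d}

/-- `SL_n(ℤ)` viewed as a set of real matrices. -/
def Gam (n : ℕ) : Set (Matrix (Fin n) (Fin n) ℝ) :=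
  {γ | γ.det = 1 ∧ ∀ i j, ∃ m : ℤ, γ i j = (m : ℝ)}

/-- The lattice `g·ℤⁿ` associated to a matrix `g`. -/
def latticeOf {n : ℕ} (g : Matrix (Fin n) (Fin n) ℝ) : AddSubgroup (Fin n → ℝ) :=
  AddSubgroup.closure (Set.range fun m : Fin n → ℤ => g.mulVec fun i => (m i : ℝ))

/-- The image `g·L` of a lattice under a matrix. -/
def mapLat {n : ℕ} (g : Matrix (Fin n) (Fin n) ℝ) (L : AddSubgroup (Fin n → ℝ)) :
    AddSubgroup (Fin n → ℝ) :=
  AddSubgroup.map (Matrix.mulVecLin g).toAddMonoidHom L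

/-- The full preimage `A·g·Γ` in `SL_n(ℝ)` of the orbit `A·[g] ⊆ ℒ_n`; a point `[h] ∈ ℒ_n`
lies in the closure of `A·[g]` iff `h ∈ closure (AOrbit g)`. -/
def AOrbit {n : ℕ} (g : Matrix (Fin n) (Fin n) ℝ) : Set (Matrix (Fin n) (Fin n) ℝ) :=
  {p | ∃ a ∈ Apos n, ∃ γ ∈ Gam n, p = a * g * γ}

/-- The orbit `A·[g] ⊆ ℒ_n` is bounded (has compact closure). -/
def HasBoundedAOrbit {n : ℕ} (g : Matrix (Fin n) (Fin n) ℝ) : Prop :=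
  ∃ K : Set (Matrix (Fin n) (Fin n) ℝ), IsCompact K ∧
    ∀ a ∈ Apos n, ∃ γ ∈ Gam n, a * g * γ ∈ K

/-! ### `α`, `Min_δ`, `V_δ`, `dim_δ` -/

/-- `α(x) = min { |Λ|^{1/r(Λ)} : Λ a nonzero subgroup of x }`. -/
def alpha {n : ℕ} (x : AddSubgroup (Fin n → ℝ)) : ℝ :=
  sInf {c | ∃ Λ : AddSubgroup (Fin n → ℝ), Λ ≤ x ∧ Λ ≠ ⊥ ∧ c = covol Λ ^ ((rk Λ : ℝ)⁻¹)}

/-- `α_k(x) = min { |Λ|^{1/k} : Λ a rank-`k` subgroup of x }`. -/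
def alphak {n : ℕ} (k : ℕ) (x : AddSubgroup (Fin n → ℝ)) : ℝ :=
  sInf {c | ∃ Λ : AddSubgroup (Fin n → ℝ), Λ ≤ x ∧ rk Λ = k ∧ c = covol Λ ^ ((k : ℝ)⁻¹)}

/-- `Min_δ(x)`: nonzero subgroups nearly attaining `α(x)`. -/
def MinSet {n : ℕ} (δ : ℝ) (x : AddSubgroup (Fin n → ℝ)) : Set (AddSubgroup (Fin n → ℝ)) :=
  {Λ | Λ ≤ x ∧ Λ ≠ ⊥ ∧ covol Λ ^ ((rk Λ : ℝ)⁻¹) < (1 + δ) * alpha x}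

/-- `V_δ(x)`: the span of the subgroups in `Min_δ(x)`. -/
def Vdelta {n : ℕ} (δ : ℝ) (x : AddSubgroup (Fin n → ℝ)) : Submodule ℝ (Fin n → ℝ) :=
  Submodule.span ℝ (⋃ Λ ∈ MinSet δ x, (Λ : Set (Fin n → ℝ)))

/-- `dim_δ(x) = dim V_δ(x)`. -/
def dimdelta {n : ℕ} (δ : ℝ) (x : AddSubgroup (Fin n → ℝ)) : ℕ :=
  Module.finrank ℝ (Vdelta δ x)

/-- `U_k^{x,ε} ⊆ A`: those `a` for which `δ ↦ dim_δ(ax)` equals `k` near `kε`. -/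
def Uset {n : ℕ} (x : AddSubgroup (Fin n → ℝ)) (ε : ℝ) (k : ℕ) :
    Set (Matrix (Fin n) (Fin n) ℝ) :=
  {a | a ∈ Apos n ∧ ∃ s ∈ 𝓝 ((k : ℝ) * ε), ∀ δ ∈ s, dimdelta δ (mapLat a x) = k}

/-- Logarithmic coordinates on the diagonal group. -/
def logCoord {n : ℕ} (a : Matrix (Fin n) (Fin n) ℝ) : Fin n → ℝ := fun i => Real.log (a i i)

/-! ### Covering radius -/

/-- The covering radius `covrad(L) = sup_u inf_{v ∈ L} ‖u - v‖`. -/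
def covrad {n : ℕ} (L : AddSubgroup (Fin n → ℝ)) : ℝ :=
  ⨆ u : Fin n → ℝ, ⨅ v : L, enorm (u - (v : Fin n → ℝ))

/-- `[g]` is a local maximum of `covrad : ℒ_d → ℝ` (phrased via the open quotient
`SL_d(ℝ) → ℒ_d`). -/
def IsLocalMaxCovrad {d : ℕ} (g : Matrix (Fin d) (Fin d) ℝ) : Prop :=
  ∃ W ∈ 𝓝 g, ∀ g' ∈ W, Matrix.det g' = 1 → covrad (latticeOf g') ≤ covrad (latticeOf g)

/-! ### Block upper triangular form -/

/-- Offset of the `i`-th diagonal block. -/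
def off {k : ℕ} (ns : Fin k → ℕ) (i : Fin k) : ℕ :=
  ∑ j ∈ Finset.univ.filter (fun j => j < i), ns j

lemma off_add_lt {k : ℕ} (ns : Fin k → ℕ) (i : Fin k) (a : Fin (ns i)) :
    off ns i + (a : ℕ) < ∑ j, ns j := by
  unfold off
  have hins : i ∉ Finset.univ.filter (fun j => j < i) := by simp
  have h2 : ∑ j ∈ insert i (Finset.univ.filter (fun j => j < i)), ns j ≤ ∑ j, ns j :=
    Finset.sum_le_sum_of_subset (Finset.subset_univ _)
  rw [Finset.sum_insert hins] at h2
  have := a.isLt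
  omega

/-- The position, in `Fin n`, of the `a`-th coordinate of the `i`-th block. -/
def blockEmb {n k : ℕ} (ns : Fin k → ℕ) (hsum : (∑ j, ns j) = n) (i : Fin k)
    (a : Fin (ns i)) : Fin n :=
  ⟨off ns i + (a : ℕ), hsum ▸ off_add_lt ns i a⟩

/-- `g` is block upper triangular with diagonal blocks `G i` (block sizes `ns`). -/
def IsBlockUT {n k : ℕ} (ns : Fin k → ℕ) (hsum : (∑ j, ns j) = n)
    (g : Matrix (Fin n) (Fin n) ℝ) (G : ∀ i, Matrix (Fin (ns i)) (Fin (ns i)) ℝ) : Prop :=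
  (∀ (i : Fin k) (a b : Fin (ns i)),
      g (blockEmb ns hsum i a) (blockEmb ns hsum i b) = G i a b) ∧
  (∀ (i j : Fin k) (a : Fin (ns i)) (b : Fin (ns j)), j < i →
      g (blockEmb ns hsum i a) (blockEmb ns hsum j b) = 0)

/-! ### Mordell constant -/

/-- The symmetric box `[-a₁,a₁] × ⋯ × [-aₙ,aₙ]` is admissible for `L`: its interior contains
no nonzero point of `L`. -/
def IsAdmissibleBox {n : ℕ} (L : AddSubgroup (Fin n → ℝ)) (a : Fin n → ℝ) : Prop :=
  (∀ i, 0 < a i) ∧ ∀ v ∈ L, v ≠ 0 → ∃ i, a i ≤ |v i|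

/-- The Mordell constant `κ(L) = 2⁻ⁿ sup { Vol(B) : B admissible symmetric box for L }`. -/
def mordellConst {n : ℕ} (L : AddSubgroup (Fin n → ℝ)) : ℝ :=
  (1 / 2 ^ n) * sSup {V | ∃ a : Fin n → ℝ, IsAdmissibleBox L a ∧ V = ∏ i, 2 * a i}

/-! ### Hermite constant -/

/-- Length of a shortest nonzero vector of `L`. -/
def shortest {m : ℕ} (L : AddSubgroup (Fin m → ℝ)) : ℝ :=
  sInf {t | ∃ w ∈ L, w ≠ 0 ∧ t = enorm w}

/-- The Hermite constant `γ_m`. -/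
def hermiteConst (m : ℕ) : ℝ :=
  sSup {c | ∃ L : AddSubgroup (Fin m → ℝ), IsUnimodularLattice L ∧ c = shortest L ^ 2}

/-! ### Korkine–Zolotarev reduction -/

/-- `v 0, …, v (n-1)` is a Korkine–Zolotarev reduced basis of `x`: it is a ℤ-basis, and for
each `i` the orthogonal projection of `v i` onto `span(v 0, …, v (i-1))^⊥` is shortest among the
nonzero such projections of vectors of `x` (projection lengths are expressed through Gram
determinants: the projection of `w` has length `gvol (v 0, …, v (i-1), w) / gvol (v 0, …, v (i-1))`). -/
def IsKZBasis {n : ℕ} (x : AddSubgroup (Fin n → ℝ)) (v : ℕ → (Fin n → ℝ)) : Prop :=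
  LinearIndependent ℝ (fun j : Fin n => v (j : ℕ)) ∧
  x = AddSubgroup.closure (v '' Set.Iio n) ∧
  ∀ i < n, ∀ w ∈ x, w ∉ Submodule.span ℝ (v '' Set.Iio i) →
    gvol (Fin.snoc (fun j : Fin i => v (j : ℕ)) (v i)) ≤
      gvol (Fin.snoc (fun j : Fin i => v (j : ℕ)) w)

/-- `A 0, …, A (n-1)` are the diagonal Korkine–Zolotarev coefficients of `x`: the lengths of
the successive orthogonal projections in a KZ reduced basis, i.e.
`A i = gvol (v 0, …, v i) / gvol (v 0, …, v (i-1))`. -/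
def HasKZCoeffs {n : ℕ} (x : AddSubgroup (Fin n → ℝ)) (A : ℕ → ℝ) : Prop :=
  ∃ v : ℕ → (Fin n → ℝ), IsKZBasis x v ∧
    ∀ i < n, A i * gvol (fun j : Fin i => v (j : ℕ)) = gvol (fun j : Fin (i + 1) => v (j : ℕ))

/-! ### Orthogonal complements and projections of lattices -/

/-- The orthogonal complement of a subspace `V ⊆ ℝⁿ`. -/
def orthoC {n : ℕ} (V : Submodule ℝ (Fin n → ℝ)) : Submodule ℝ (Fin n → ℝ) where
  carrier := {w | ∀ v ∈ V, einner w v = 0}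
  zero_mem' := by intro v hv; simp [einner]
  add_mem' := by intro a b ha hb v hv; rw [einner_add_left, ha v hv, hb v hv, add_zero]
  smul_mem' := by intro c w hw v hv; rw [einner_smul_left, hw v hv, mul_zero]

/-- The image `π(x)` of `x` under the orthogonal projection `π : ℝⁿ → V^⊥`:
`p = π(u)` iff `p ⊥ V` and `u - p ∈ V`. -/
def projLat {n : ℕ} (V : Submodule ℝ (Fin n → ℝ)) (x : AddSubgroup (Fin n → ℝ)) :
    AddSubgroup (Fin n → ℝ) where
  carrier := {p | (∀ v ∈ V, einner p v = 0) ∧ ∃ u ∈ x, u - p ∈ V}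
  zero_mem' := ⟨by intro v hv; simp [einner], 0, x.zero_mem, by rw [sub_zero]; exact V.zero_mem⟩
  add_mem' := by
    rintro p q ⟨hp1, u1, hu1, hp2⟩ ⟨hq1, u2, hu2, hq2⟩
    refine ⟨fun v hv => by rw [einner_add_left, hp1 v hv, hq1 v hv, add_zero],
      u1 + u2, x.add_mem hu1 hu2, ?_⟩
    have h : u1 + u2 - (p + q) = u1 - p + (u2 - q) := by abel
    rw [h]; exact V.add_mem hp2 hq2
  neg_mem' := by
    rintro p ⟨hp1, u, hu, hp2⟩
    refine ⟨fun v hv => by rw [einner_neg_left, hp1 v hv, neg_zero],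
      -u, x.neg_mem hu, ?_⟩
    have h : -u - -p = -(u - p) := by abel
    rw [h]; exact V.neg_mem hp2

end SW

namespace SW

section Determinant

open scoped MatrixOrder

lemma one_le_det_of_posSemidef_sub_one {m : Type*} [Fintype m] [DecidableEq m]
    {C : Matrix m m ℝ} (hC : (C - 1).PosSemidef) : 1 ≤ C.det := by
  have hH : C.IsHermitian := by
    have := hC.isHermitian.add ((isHermitian_one : (1 : Matrix m m ℝ).IsHermitian))
    rwa [sub_add_cancel] at this
  rw [hH.det_eq_prod_eigenvalues]
  refine Finset.one_le_prod fun i _ => ?_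
  have h := hC.dotProduct_mulVec_nonneg (hH.eigenvectorBasis i)
  have h1 : star (⇑(hH.eigenvectorBasis i)) ⬝ᵥ ⇑(hH.eigenvectorBasis i) = 1 := by
    have := hH.eigenvectorBasis.orthonormal.1 i
    rw [dotProduct_comm, ← EuclideanSpace.inner_eq_star_dotProduct,
      inner_self_eq_norm_sq_to_K, this]
    simp
  rw [sub_mulVec, one_mulVec, hH.mulVec_eigenvectorBasis, dotProduct_sub, dotProduct_smul, h1] at h
  simpa using h

lemma det_le_det_of_posSemidef_sub {m : Type*} [Fintype m] [DecidableEq m]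
    {A B : Matrix m m ℝ} (hA : A.PosDef) (hAB : (B - A).PosSemidef) : A.det ≤ B.det := by
  obtain ⟨S, hS⟩ := CStarAlgebra.nonneg_iff_eq_star_mul_self.mp hA.posSemidef.nonneg
  rw [Matrix.star_eq_conjTranspose] at hS
  have hSdet : IsUnit S.det := by
    have h := hA.det_pos
    rw [hS, det_mul] at h
    exact isUnit_iff_ne_zero.mpr (right_ne_zero_of_mul h.ne')
  have hinv : S * S⁻¹ = 1 := mul_nonsing_inv S hSdet
  have hinv' : (S⁻¹)ᴴ * Sᴴ = 1 := by rw [← conjTranspose_mul, hinv, conjTranspose_one]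
  have hC := hAB.conjTranspose_mul_mul_same S⁻¹
  have hone : (S⁻¹)ᴴ * (B - A) * S⁻¹ = (S⁻¹)ᴴ * B * S⁻¹ - 1 := by
    rw [mul_sub, sub_mul, hS, ← mul_assoc, hinv', one_mul, hinv]
  rw [hone] at hC
  have h1 := one_le_det_of_posSemidef_sub_one hC
  have hB : B.det = A.det * ((S⁻¹)ᴴ * B * S⁻¹).det := by
    have e1 := congrArg det hinv
    have e2 := congrArg det hinv'
    rw [det_mul, det_one] at e1 e2
    rw [hS]
    simp only [det_mul]
    linear_combination (-B.det) * e2 - B.det * ((S⁻¹)ᴴ.det * (Sᴴ).det) * e1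
  rw [hB]
  exact le_mul_of_one_le_right hA.det_pos.le h1

end Determinant

lemma gram_eq_mul_conjTranspose {n r : ℕ} (v : Fin r → (Fin n → ℝ)) :
    (Matrix.of fun i j => einner (v i) (v j)) = Matrix.of v * (Matrix.of v)ᴴ := by
  ext i j
  simp [einner, mul_apply]

lemma posDef_gram {n r : ℕ} {v : Fin r → (Fin n → ℝ)} (hv : LinearIndependent ℝ v) :
    (Matrix.of fun i j => einner (v i) (v j)).PosDef := by
  rw [gram_eq_mul_conjTranspose]
  exact PosDef.mul_conjTranspose_self _ (Matrix.vecMul_injective_iff.mpr hv)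

lemma linearIndependent_mulVec {n r : ℕ} {b : Matrix (Fin n) (Fin n) ℝ} (hb : IsUnit b.det)
    {v : Fin r → (Fin n → ℝ)} (hv : LinearIndependent ℝ v) :
    LinearIndependent ℝ fun i => b *ᵥ v i :=
  hv.map_injOn b.mulVecLin
    (Matrix.mulVec_injective_of_isUnit ((isUnit_iff_isUnit_det b).mpr hb)).injOn

lemma dotProduct_gram_mulVec {n r : ℕ} (v : Fin r → (Fin n → ℝ)) (x : Fin r → ℝ) :
    star x ⬝ᵥ ((Matrix.of fun i j => einner (v i) (v j)) *ᵥ x) =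
      einner (∑ i, x i • v i) (∑ i, x i • v i) := by
  have h : (∑ i, x i • v i) = x ᵥ* Matrix.of v := by
    rw [vecMul_eq_sum]
    rfl
  have h2 : (Matrix.of v)ᴴ *ᵥ x = x ᵥ* Matrix.of v := by
    rw [conjTranspose_eq_transpose_of_trivial, mulVec_transpose]
  rw [gram_eq_mul_conjTranspose, ← mulVec_mulVec, dotProduct_mulVec, h2, h, star_trivial]
  rfl

/-- The matrix `b` stretches Euclidean lengths by a factor at most `c`. -/
def StretchLE {n : ℕ} (b : Matrix (Fin n) (Fin n) ℝ) (c : ℝ) : Prop :=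
  ∀ u, einner (b *ᵥ u) (b *ᵥ u) ≤ c ^ 2 * einner u u

/-- A linear map that stretches Euclidean lengths by a factor at most `c` stretches
`r`-dimensional volumes by a factor at most `c ^ r`. -/
lemma gvol_mulVec_le {n r : ℕ} {b : Matrix (Fin n) (Fin n) ℝ} (hb : IsUnit b.det) {c : ℝ}
    (hc : 0 ≤ c) (h : StretchLE b c)
    {v : Fin r → (Fin n → ℝ)} (hv : LinearIndependent ℝ v) :
    gvol (fun i => b *ᵥ v i) ≤ c ^ r * gvol v := by
  have hdet := det_le_det_of_posSemidef_sub (posDef_gram (linearIndependent_mulVec hb hv))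
    (B := c ^ 2 • Matrix.of fun i j => einner (v i) (v j)) (by
      refine .of_dotProduct_mulVec_nonneg ?_ fun x => ?_
      · exact ((posDef_gram hv).posSemidef.smul (sq_nonneg c)).isHermitian.sub
          (posDef_gram (linearIndependent_mulVec hb hv)).isHermitian
      · rw [sub_mulVec, dotProduct_sub, smul_mulVec, dotProduct_smul, dotProduct_gram_mulVec,
          dotProduct_gram_mulVec]
        have := h (∑ i, x i • v i)
        simp only [mulVec_sum, mulVec_smul] at this
        simpa using this)
  rw [det_smul, Fintype.card_fin, ← pow_mul, mul_comm 2 r, pow_mul] at hdet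
  unfold gvol
  refine (Real.sqrt_le_sqrt hdet).trans_eq ?_
  rw [Real.sqrt_mul (sq_nonneg _), Real.sqrt_sq (pow_nonneg hc r)]

lemma exists_stretchLE {n : ℕ} (b : Matrix (Fin n) (Fin n) ℝ) :
    ∃ c : ℝ, 0 < c ∧ StretchLE b c := by
  have h0 : 0 ≤ ∑ i, ∑ j, b i j ^ 2 :=
    Finset.sum_nonneg fun i _ => Finset.sum_nonneg fun j _ => sq_nonneg _
  refine ⟨√(∑ i, ∑ j, b i j ^ 2 + 1), by positivity, fun u => ?_⟩
  rw [Real.sq_sqrt (by positivity), add_mul, Finset.sum_mul]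
  have hu : einner u u = ∑ j, u j ^ 2 := by simp [einner, sq]
  rw [hu]
  have : einner (b *ᵥ u) (b *ᵥ u) ≤ ∑ i, (∑ j, b i j ^ 2) * ∑ j, u j ^ 2 := by
    refine Finset.sum_le_sum fun i _ => ?_
    rw [← sq]
    exact Finset.sum_mul_sq_le_sq_mul_sq Finset.univ (b i) u
  have h2 : 0 ≤ ∑ j, u j ^ 2 := Finset.sum_nonneg fun j _ => sq_nonneg _
  linarith

lemma gvol_nonneg {n r : ℕ} (v : Fin r → (Fin n → ℝ)) : 0 ≤ gvol v := Real.sqrt_nonneg _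

/-! ### Images of subgroups under invertible matrices -/

lemma mapLat_mono {n : ℕ} (b : Matrix (Fin n) (Fin n) ℝ) {Λ x : AddSubgroup (Fin n → ℝ)}
    (h : Λ ≤ x) : mapLat b Λ ≤ mapLat b x :=
  AddSubgroup.map_mono h

lemma mapLat_mapLat {n : ℕ} (b c : Matrix (Fin n) (Fin n) ℝ) (Λ : AddSubgroup (Fin n → ℝ)) :
    mapLat b (mapLat c Λ) = mapLat (b * c) Λ := by
  ext v
  simp [mapLat, AddSubgroup.mem_map]

lemma mapLat_one {n : ℕ} (Λ : AddSubgroup (Fin n → ℝ)) : mapLat 1 Λ = Λ := by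
  ext v
  simp [mapLat, AddSubgroup.mem_map]

lemma mapLat_inv_mapLat {n : ℕ} {b : Matrix (Fin n) (Fin n) ℝ} (hb : IsUnit b.det)
    (Λ : AddSubgroup (Fin n → ℝ)) : mapLat b⁻¹ (mapLat b Λ) = Λ := by
  rw [mapLat_mapLat, nonsing_inv_mul b hb, mapLat_one]

lemma mapLat_ne_bot {n : ℕ} {b : Matrix (Fin n) (Fin n) ℝ} (hb : IsUnit b.det)
    {Λ : AddSubgroup (Fin n → ℝ)} (h : Λ ≠ ⊥) : mapLat b Λ ≠ ⊥ := by
  intro h'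
  apply h
  rw [← mapLat_inv_mapLat hb Λ, h', mapLat, AddSubgroup.map_bot]

lemma span_mapLat {n : ℕ} (b : Matrix (Fin n) (Fin n) ℝ) (Λ : AddSubgroup (Fin n → ℝ)) :
    Submodule.span ℝ (mapLat b Λ : Set (Fin n → ℝ)) =
      (Submodule.span ℝ (Λ : Set (Fin n → ℝ))).map b.mulVecLin := by
  rw [Submodule.map_span]
  rfl

lemma mulVecLin_injective {n : ℕ} {b : Matrix (Fin n) (Fin n) ℝ} (hb : IsUnit b.det) :
    Function.Injective b.mulVecLin :=
  Matrix.mulVec_injective_of_isUnit ((isUnit_iff_isUnit_det b).mpr hb)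

lemma rk_mapLat {n : ℕ} {b : Matrix (Fin n) (Fin n) ℝ} (hb : IsUnit b.det)
    (Λ : AddSubgroup (Fin n → ℝ)) : rk (mapLat b Λ) = rk Λ := by
  unfold rk
  rw [span_mapLat]
  exact (Submodule.equivMapOfInjective _ (mulVecLin_injective hb) _).finrank_eq.symm

lemma rk_ne_zero {n : ℕ} {Λ : AddSubgroup (Fin n → ℝ)} (h : Λ ≠ ⊥) : rk Λ ≠ 0 := by
  intro h0
  apply h
  rw [rk, Submodule.finrank_eq_zero, Submodule.span_eq_bot] at h0
  exact (AddSubgroup.eq_bot_iff_forall _).mpr h0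

lemma rk_closure_range {n r : ℕ} {v : Fin r → (Fin n → ℝ)} (hv : LinearIndependent ℝ v) :
    rk (AddSubgroup.closure (Set.range v)) = r := by
  have h : Submodule.span ℝ (AddSubgroup.closure (Set.range v) : Set (Fin n → ℝ)) =
      Submodule.span ℝ (Set.range v) := by
    refine le_antisymm (Submodule.span_le.mpr ?_)
      (Submodule.span_mono AddSubgroup.subset_closure)
    exact (AddSubgroup.closure_le (Submodule.span ℝ (Set.range v)).toAddSubgroup).mpr
      Submodule.subset_span
  rw [rk, h, finrank_span_eq_card hv, Fintype.card_fin]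

/-! ### Covolumes -/

lemma covolSpec_nonneg {n : ℕ} {Λ : AddSubgroup (Fin n → ℝ)} {d : ℝ} (h : covolSpec Λ d) :
    0 ≤ d := by
  obtain ⟨r, v, -, -, rfl⟩ := h
  exact gvol_nonneg v

lemma covol_nonneg {n : ℕ} (Λ : AddSubgroup (Fin n → ℝ)) : 0 ≤ covol Λ :=
  Real.sInf_nonneg fun _ h => covolSpec_nonneg h

lemma covol_mapLat_le {n : ℕ} {b : Matrix (Fin n) (Fin n) ℝ} (hb : IsUnit b.det) {c : ℝ}
    (hc : 0 < c) (h : StretchLE b c) {Λ : AddSubgroup (Fin n → ℝ)} (hΛ : ∃ d, covolSpec Λ d) :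
    covol (mapLat b Λ) ≤ c ^ rk Λ * covol Λ := by
  rw [← div_le_iff₀' (pow_pos hc _)]
  refine le_csInf hΛ ?_
  rintro d ⟨r, v, hv, rfl, rfl⟩
  rw [div_le_iff₀' (pow_pos hc _), rk_closure_range hv]
  refine (csInf_le ⟨0, fun _ h => covolSpec_nonneg h⟩ ?_).trans (gvol_mulVec_le hb hc.le h hv)
  refine ⟨r, _, linearIndependent_mulVec hb hv, ?_, rfl⟩
  rw [mapLat, AddMonoidHom.map_closure, ← Set.range_comp]
  rfl

/-- The normalized covolume `|Λ|^{1/r(Λ)}`. -/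
def ncovol {n : ℕ} (Λ : AddSubgroup (Fin n → ℝ)) : ℝ := covol Λ ^ ((rk Λ : ℝ)⁻¹)

lemma ncovol_nonneg {n : ℕ} (Λ : AddSubgroup (Fin n → ℝ)) : 0 ≤ ncovol Λ :=
  Real.rpow_nonneg (covol_nonneg Λ) _

lemma ncovol_mapLat_le {n : ℕ} {b : Matrix (Fin n) (Fin n) ℝ} (hb : IsUnit b.det) {c : ℝ}
    (hc : 0 < c) (h : StretchLE b c) {Λ : AddSubgroup (Fin n → ℝ)} (hΛ : ∃ d, covolSpec Λ d)
    (h0 : Λ ≠ ⊥) : ncovol (mapLat b Λ) ≤ c * ncovol Λ := by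
  unfold ncovol
  rw [rk_mapLat hb]
  refine (Real.rpow_le_rpow (covol_nonneg _) (covol_mapLat_le hb hc h hΛ)
    (by positivity)).trans_eq ?_
  rw [Real.mul_rpow (by positivity) (covol_nonneg _),
    Real.pow_rpow_inv_natCast hc.le (rk_ne_zero h0)]

/-! ### Subgroups of lattices -/

/-- The homomorphism `m ↦ h m` from `ℤⁿ` to `ℝⁿ`. -/
def latHom {n : ℕ} (h : Matrix (Fin n) (Fin n) ℝ) : (Fin n → ℤ) →+ (Fin n → ℝ) where
  toFun m := h *ᵥ fun i => (m i : ℝ)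
  map_zero' := by
    simp only [Pi.zero_apply, Int.cast_zero]
    exact mulVec_zero h
  map_add' m m' := by
    rw [← mulVec_add]
    congr 1
    ext i
    simp

lemma latticeOf_eq_range {n : ℕ} (h : Matrix (Fin n) (Fin n) ℝ) :
    latticeOf h = (latHom h).range :=
  AddSubgroup.closure_eq (latHom h).range

lemma mapLat_latticeOf {n : ℕ} (b h : Matrix (Fin n) (Fin n) ℝ) :
    mapLat b (latticeOf h) = latticeOf (b * h) := by
  ext v
  simp [latticeOf_eq_range, mapLat, latHom, AddSubgroup.mem_map]

lemma linearIndependent_intCast {n r : ℕ} {w : Fin r → (Fin n → ℤ)} :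
    LinearIndependent ℝ (fun i j => (w i j : ℝ)) ↔ LinearIndependent ℤ w :=
  linearIndependent_algebraMap_comp_iff (R := ℤ) (S := ℝ)

lemma exists_covolSpec {n : ℕ} {h : Matrix (Fin n) (Fin n) ℝ} (hh : IsUnit h.det)
    {Λ : AddSubgroup (Fin n → ℝ)} (hΛ : Λ ≤ latticeOf h) : ∃ d, covolSpec Λ d := by
  rw [latticeOf_eq_range] at hΛ
  obtain ⟨r, B⟩ := Submodule.basisOfPid (Pi.basisFun ℤ (Fin n))
    (AddSubgroup.toIntSubmodule (Λ.comap (latHom h)))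
  have hlin : LinearIndependent ℤ fun i => (B i : Fin n → ℤ) :=
    B.linearIndependent.map' (Submodule.subtype _) (Submodule.ker_subtype _)
  have hspan : AddSubgroup.closure (Set.range fun i => (B i : Fin n → ℤ)) =
      Λ.comap (latHom h) := by
    have h1 : Submodule.span ℤ (Set.range fun i => (B i : Fin n → ℤ)) =
        AddSubgroup.toIntSubmodule (Λ.comap (latHom h)) := by
      have := congrArg (Submodule.map (Submodule.subtype _)) B.span_eq
      rw [Submodule.map_span, ← Set.range_comp, Submodule.map_subtype_top] at this
      exact this
    rw [← Submodule.span_int_eq_addSubgroupClosure, h1]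
    rfl
  refine ⟨_, r, _, linearIndependent_mulVec hh (linearIndependent_intCast.mpr hlin), ?_, rfl⟩
  refine (AddSubgroup.map_comap_eq_self hΛ).symm.trans
    ((congrArg (AddSubgroup.map (latHom h)) hspan.symm).trans ?_)
  rw [AddMonoidHom.map_closure, ← Set.range_comp]
  rfl

lemma one_le_gvol_intCast {n r : ℕ} {w : Fin r → (Fin n → ℤ)}
    (hw : LinearIndependent ℝ (fun i j => (w i j : ℝ))) :
    1 ≤ gvol (fun i j => (w i j : ℝ)) := by
  have hpos := (posDef_gram hw).det_pos
  unfold gvol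
  rw [Real.one_le_sqrt]
  have hint : (Matrix.of fun i j => einner (fun k => (w i k : ℝ)) (fun k => (w j k : ℝ))) =
      (Int.castRingHom ℝ).mapMatrix (Matrix.of fun i j => ∑ k, w i k * w j k) := by
    ext i j
    simp [einner]
  rw [hint, ← RingHom.map_det] at hpos ⊢
  simp only [eq_intCast] at hpos ⊢
  exact_mod_cast hpos

lemma exists_pos_le_ncovol {n : ℕ} {h : Matrix (Fin n) (Fin n) ℝ} (hh : IsUnit h.det) :
    ∃ c : ℝ, 0 < c ∧ ∀ Λ ≤ latticeOf h, Λ ≠ ⊥ → c ≤ ncovol Λ := by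
  have hh' : IsUnit (h⁻¹).det := by
    rw [det_nonsing_inv]
    exact hh.ringInverse
  obtain ⟨C, hC, hCle⟩ := exists_stretchLE h⁻¹
  refine ⟨C⁻¹, inv_pos.mpr hC, fun Λ hΛ h0 => ?_⟩
  have key : (C⁻¹) ^ rk Λ ≤ covol Λ := by
    refine le_csInf (exists_covolSpec hh hΛ) ?_
    rintro d ⟨r, v, hv, rfl, rfl⟩
    rw [rk_closure_range hv, inv_pow, inv_le_iff_one_le_mul₀' (pow_pos hC r)]
    have hmem : ∀ i, ∃ m : Fin n → ℤ, (fun j => (m j : ℝ)) = h⁻¹ *ᵥ v i := fun i => by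
      have := hΛ (AddSubgroup.subset_closure (Set.mem_range_self i))
      rw [latticeOf_eq_range] at this
      obtain ⟨m, hm⟩ := this
      refine ⟨m, ?_⟩
      rw [← hm]
      simp [latHom, nonsing_inv_mul h hh]
    choose w hw using hmem
    have hlin := linearIndependent_mulVec hh' hv
    have hle := gvol_mulVec_le hh' hC.le hCle hv
    simp only [← hw] at hlin hle
    exact (one_le_gvol_intCast hlin).trans hle
  have := Real.rpow_le_rpow (by positivity) key (by positivity : 0 ≤ ((rk Λ : ℝ)⁻¹))
  rwa [Real.pow_rpow_inv_natCast (by positivity) (rk_ne_zero h0)] at this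

/-! ### Variation of `α`, `V_δ` and `dim_δ` along the diagonal group -/

lemma latticeOf_ne_bot {n : ℕ} (hn : 0 < n) {h : Matrix (Fin n) (Fin n) ℝ} (hh : IsUnit h.det) :
    latticeOf h ≠ ⊥ := by
  intro hbot
  have hmem : latHom h 1 ∈ latticeOf h := by
    rw [latticeOf_eq_range]
    exact ⟨1, rfl⟩
  rw [hbot, AddSubgroup.mem_bot] at hmem
  have h1 : h *ᵥ (1 : Fin n → ℝ) = h *ᵥ 0 := by
    rw [mulVec_zero, ← hmem]
    simp [latHom, Pi.one_def]
  have := congrFun (mulVecLin_injective hh h1) ⟨0, hn⟩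
  simp at this

lemma alpha_le {n : ℕ} {x Λ : AddSubgroup (Fin n → ℝ)} (hΛ : Λ ≤ x) (h0 : Λ ≠ ⊥) :
    alpha x ≤ ncovol Λ :=
  csInf_le ⟨0, by rintro _ ⟨Λ, -, -, rfl⟩; exact ncovol_nonneg Λ⟩ ⟨Λ, hΛ, h0, rfl⟩

lemma le_alpha {n : ℕ} {x : AddSubgroup (Fin n → ℝ)} (hx : x ≠ ⊥) {c : ℝ}
    (h : ∀ Λ ≤ x, Λ ≠ ⊥ → c ≤ ncovol Λ) : c ≤ alpha x :=
  le_csInf ⟨_, x, le_rfl, hx, rfl⟩ (by rintro _ ⟨Λ, hΛ, h0, rfl⟩; exact h Λ hΛ h0)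

lemma alpha_nonneg {n : ℕ} (x : AddSubgroup (Fin n → ℝ)) : 0 ≤ alpha x :=
  Real.sInf_nonneg (by rintro _ ⟨Λ, -, -, rfl⟩; exact ncovol_nonneg Λ)

lemma alpha_latticeOf_pos {n : ℕ} (hn : 0 < n) {h : Matrix (Fin n) (Fin n) ℝ}
    (hh : IsUnit h.det) : 0 < alpha (latticeOf h) := by
  obtain ⟨c, hc, hle⟩ := exists_pos_le_ncovol hh
  exact hc.trans_le (le_alpha (latticeOf_ne_bot hn hh) hle)

lemma alpha_le_mul_alpha_mapLat {n : ℕ} (hn : 0 < n) {h : Matrix (Fin n) (Fin n) ℝ}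
    (hh : IsUnit h.det) {b : Matrix (Fin n) (Fin n) ℝ} (hb : IsUnit b.det) {c : ℝ} (hc : 0 < c)
    (hinv : StretchLE b⁻¹ c) : alpha (latticeOf h) ≤ c * alpha (mapLat b (latticeOf h)) := by
  have hb' : IsUnit (b⁻¹).det := by
    rw [det_nonsing_inv]
    exact hb.ringInverse
  have hbh : IsUnit (b * h).det := by
    rw [det_mul]
    exact hb.mul hh
  rw [← div_le_iff₀' hc]
  refine le_alpha (mapLat_ne_bot hb (latticeOf_ne_bot hn hh)) fun Λ hΛ h0 => ?_
  rw [div_le_iff₀' hc]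
  have hle := mapLat_mono b⁻¹ hΛ
  rw [mapLat_inv_mapLat hb] at hle
  rw [mapLat_latticeOf] at hΛ
  exact (alpha_le hle (mapLat_ne_bot hb' h0)).trans
    (ncovol_mapLat_le hb' hc hinv (exists_covolSpec hbh hΛ) h0)

lemma Vdelta_map_le {n : ℕ} (hn : 0 < n) {h : Matrix (Fin n) (Fin n) ℝ}
    (hh : IsUnit h.det) {b : Matrix (Fin n) (Fin n) ℝ} (hb : IsUnit b.det) {c : ℝ} (hc : 0 < c)
    (hle : StretchLE b c) (hinv : StretchLE b⁻¹ c) {δ δ' : ℝ}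
    (hδ : c ^ 2 * (1 + δ) ≤ 1 + δ') :
    (Vdelta δ (latticeOf h)).map b.mulVecLin ≤ Vdelta δ' (mapLat b (latticeOf h)) := by
  unfold Vdelta
  rw [Submodule.map_span]
  refine Submodule.span_mono ?_
  rintro _ ⟨v, hv, rfl⟩
  simp only [Set.mem_iUnion] at hv ⊢
  obtain ⟨Λ, ⟨hΛ, h0, hlt⟩, hvΛ⟩ := hv
  change ncovol Λ < _ at hlt
  have hδ0 : 0 < 1 + δ :=
    pos_of_mul_pos_left ((ncovol_nonneg Λ).trans_lt hlt) (alpha_nonneg _)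
  refine ⟨mapLat b Λ, ⟨mapLat_mono b hΛ, mapLat_ne_bot hb h0, ?_⟩, v, hvΛ, rfl⟩
  change ncovol _ < _
  calc ncovol (mapLat b Λ) ≤ c * ncovol Λ :=
        ncovol_mapLat_le hb hc hle (exists_covolSpec hh hΛ) h0
    _ < c * ((1 + δ) * alpha (latticeOf h)) := mul_lt_mul_of_pos_left hlt hc
    _ ≤ c * ((1 + δ) * (c * alpha (mapLat b (latticeOf h)))) := by
        gcongr
        exact alpha_le_mul_alpha_mapLat hn hh hb hc hinv
    _ = c ^ 2 * (1 + δ) * alpha (mapLat b (latticeOf h)) := by ring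
    _ ≤ _ := mul_le_mul_of_nonneg_right hδ (alpha_nonneg _)

lemma dimdelta_le_dimdelta_mapLat {n : ℕ} (hn : 0 < n) {h : Matrix (Fin n) (Fin n) ℝ}
    (hh : IsUnit h.det) {b : Matrix (Fin n) (Fin n) ℝ} (hb : IsUnit b.det) {c : ℝ} (hc : 0 < c)
    (hle : StretchLE b c) (hinv : StretchLE b⁻¹ c) {δ δ' : ℝ}
    (hδ : c ^ 2 * (1 + δ) ≤ 1 + δ') :
    dimdelta δ (latticeOf h) ≤ dimdelta δ' (mapLat b (latticeOf h)) := by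
  unfold dimdelta
  rw [(Submodule.equivMapOfInjective _ (mulVecLin_injective hb) _).finrank_eq]
  exact Submodule.finrank_mono (Vdelta_map_le hn hh hb hc hle hinv hδ)

lemma dimdelta_le {n : ℕ} (δ : ℝ) (x : AddSubgroup (Fin n → ℝ)) : dimdelta δ x ≤ n :=
  (Submodule.finrank_le _).trans_eq (by simp)

lemma one_le_dimdelta {n : ℕ} (hn : 0 < n) {h : Matrix (Fin n) (Fin n) ℝ}
    (hh : IsUnit h.det) {δ : ℝ} (hδ : 0 < δ) : 1 ≤ dimdelta δ (latticeOf h) := by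
  have hα := alpha_latticeOf_pos hn hh
  have hlt : alpha (latticeOf h) < (1 + δ) * alpha (latticeOf h) := by nlinarith
  obtain ⟨Λ, hΛ, h0, hΛlt⟩ : ∃ Λ ≤ latticeOf h, Λ ≠ ⊥ ∧
      ncovol Λ < (1 + δ) * alpha (latticeOf h) := by
    by_contra! hcon
    exact hlt.not_ge (le_alpha (latticeOf_ne_bot hn hh) hcon)
  rw [Nat.one_le_iff_ne_zero]
  intro hdim
  apply h0
  rw [dimdelta, Submodule.finrank_eq_zero, Vdelta, Submodule.span_eq_bot] at hdim
  exact (AddSubgroup.eq_bot_iff_forall _).mpr fun v hv =>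
    hdim v (Set.mem_biUnion (show Λ ∈ MinSet δ _ from ⟨hΛ, h0, hΛlt⟩) hv)

lemma stretchLE_diagonal {n : ℕ} {d : Fin n → ℝ} {c : ℝ} (h : ∀ i, |d i| ≤ c) :
    StretchLE (diagonal d) c := by
  intro u
  unfold einner
  rw [Finset.mul_sum]
  refine Finset.sum_le_sum fun i _ => ?_
  have h1 : d i ^ 2 ≤ c ^ 2 := sq_le_sq' (by linarith [neg_abs_le (d i), h i])
    ((le_abs_self _).trans (h i))
  rw [mulVec_diagonal]
  nlinarith [mul_le_mul_of_nonneg_right h1 (mul_self_nonneg (u i))]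

lemma abs_le_enorm {n : ℕ} (v : Fin n → ℝ) (i : Fin n) : |v i| ≤ enorm v := by
  rw [← Real.sqrt_sq_eq_abs]
  exact Real.sqrt_le_sqrt
    (Finset.single_le_sum (f := fun i => v i ^ 2) (fun i _ => sq_nonneg _) (Finset.mem_univ i))

lemma isUnit_det_of_mem_Apos {n : ℕ} {a : Matrix (Fin n) (Fin n) ℝ} (ha : a ∈ Apos n) :
    IsUnit a.det := by
  obtain ⟨d, -, hprod, rfl⟩ := ha
  simp [hprod]

lemma exp_log_sub_log_le {s t r : ℝ} (hs : 0 < s) (ht : 0 < t)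
    (h : |Real.log s - Real.log t| ≤ r) : |s / t| ≤ Real.exp r := by
  rw [abs_of_pos (div_pos hs ht), ← Real.exp_log (div_pos hs ht), Real.log_div hs.ne' ht.ne']
  exact Real.exp_le_exp.mpr ((le_abs_self _).trans h)

lemma dimdelta_le_of_enorm_le {n : ℕ} (hn : 0 < n) {g : Matrix (Fin n) (Fin n) ℝ}
    (hg : IsUnit g.det) {a a' : Matrix (Fin n) (Fin n) ℝ} (ha : a ∈ Apos n) (ha' : a' ∈ Apos n)
    {r : ℝ} (hr : enorm (logCoord a' - logCoord a) ≤ r) {δ δ' : ℝ}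
    (hδ : Real.exp r ^ 2 * (1 + δ) ≤ 1 + δ') :
    dimdelta δ (mapLat a (latticeOf g)) ≤ dimdelta δ' (mapLat a' (latticeOf g)) := by
  have hag : IsUnit (a * g).det := by
    rw [det_mul]
    exact (isUnit_det_of_mem_Apos ha).mul hg
  obtain ⟨d, hd, -, rfl⟩ := ha
  obtain ⟨d', hd', -, rfl⟩ := ha'
  have hlog : ∀ i, |Real.log (d' i) - Real.log (d i)| ≤ r := fun i => by
    simpa [logCoord] using (abs_le_enorm _ i).trans hr
  have hmul : diagonal d' = diagonal (fun i => d' i / d i) * diagonal d := by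
    rw [diagonal_mul_diagonal]
    congr 1
    ext i
    exact (div_mul_cancel₀ _ (hd i).ne').symm
  have hinv : (diagonal fun i => d' i / d i)⁻¹ = diagonal fun i => d i / d' i := by
    refine inv_eq_left_inv ?_
    rw [diagonal_mul_diagonal, ← diagonal_one]
    congr 1
    ext i
    have := (hd i).ne'
    have := (hd' i).ne'
    field_simp
  have hb : IsUnit (diagonal fun i => d' i / d i).det := by
    rw [det_diagonal, isUnit_iff_ne_zero]
    exact Finset.prod_ne_zero_iff.mpr fun i _ => (div_pos (hd' i) (hd i)).ne'
  rw [hmul, ← mapLat_mapLat, mapLat_latticeOf]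
  refine dimdelta_le_dimdelta_mapLat hn hag hb (Real.exp_pos r) ?_ ?_ hδ
  · exact stretchLE_diagonal fun i => exp_log_sub_log_le (hd' i) (hd i) (hlog i)
  · rw [hinv]
    refine stretchLE_diagonal fun i => exp_log_sub_log_le (hd i) (hd' i) ?_
    rw [abs_sub_comm]
    exact hlog i

lemma enorm_zero {n : ℕ} : enorm (0 : Fin n → ℝ) = 0 := by simp [enorm]

lemma enorm_sub_comm {n : ℕ} (v w : Fin n → ℝ) : enorm (v - w) = enorm (w - v) := by
  unfold enorm
  congr 1
  exact Finset.sum_congr rfl fun i _ => by simp only [Pi.sub_apply]; ring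

lemma dimdelta_mono {n : ℕ} (hn : 0 < n) {g : Matrix (Fin n) (Fin n) ℝ}
    (hg : IsUnit g.det) {a : Matrix (Fin n) (Fin n) ℝ} (ha : a ∈ Apos n) :
    Monotone fun δ => dimdelta δ (mapLat a (latticeOf g)) := fun δ δ' h =>
  dimdelta_le_of_enorm_le hn hg ha ha (r := 0) (by rw [sub_self, enorm_zero])
    (by simpa using h)

/-- If `dim_δ(ax)` equals `k` at both ends of the interval of radius `s` around `kε`, then a
ball around `a`, with radius depending only on `s` and on a bound for `k`, lies in `U_k`. -/
lemma exists_radius {n : ℕ} (hn : 0 < n) {g : Matrix (Fin n) (Fin n) ℝ} (hg : IsUnit g.det)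
    {ε s : ℝ} (hε : 0 < ε) (hs : 0 < s) :
    ∃ r : ℝ, 0 < r ∧ ∀ k ≤ n, ∀ a ∈ Apos n,
      k ≤ dimdelta (k * ε - s) (mapLat a (latticeOf g)) →
      dimdelta (k * ε + s) (mapLat a (latticeOf g)) ≤ k →
      ∀ a' ∈ Apos n, enorm (logCoord a' - logCoord a) < r → a' ∈ Uset (latticeOf g) ε k := by
  set q : ℝ := 1 + (s / 2) / (1 + n * ε + s) with hq
  have hden : 0 < 1 + n * ε + s := by positivity
  have hq1 : 1 < q := lt_add_of_pos_right _ (by positivity)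
  have hqmul : (q - 1) * (1 + n * ε + s) = s / 2 := by
    rw [hq, add_sub_cancel_left]
    exact div_mul_cancel₀ _ hden.ne'
  have hexp : Real.exp (Real.log q / 2) ^ 2 = q := by
    rw [← Real.exp_nat_mul, Nat.cast_ofNat, mul_div_cancel₀ _ two_ne_zero,
      Real.exp_log (by linarith)]
  refine ⟨Real.log q / 2, half_pos (Real.log_pos hq1), fun k hk a ha hlow hup a' ha' hlt => ?_⟩
  have hkε : (k : ℝ) * ε ≤ n * ε := by gcongr
  refine ⟨ha', Metric.ball (k * ε) (s / 2), Metric.ball_mem_nhds _ (half_pos hs), fun δ hδ => ?_⟩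
  rw [Metric.mem_ball, Real.dist_eq, abs_lt] at hδ
  refine le_antisymm (le_trans ?_ hup) (hlow.trans ?_)
  · rw [enorm_sub_comm] at hlt
    refine dimdelta_le_of_enorm_le hn hg ha' ha hlt.le ?_
    rw [hexp]
    nlinarith
  · refine dimdelta_le_of_enorm_le hn hg ha ha' hlt.le ?_
    rw [hexp]
    nlinarith

lemma exists_index {n : ℕ} (hn : 0 < n) {g : Matrix (Fin n) (Fin n) ℝ} (hg : IsUnit g.det)
    {ε : ℝ} (hε : 0 < ε) {a : Matrix (Fin n) (Fin n) ℝ} (ha : a ∈ Apos n) :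
    ∃ k : ℕ, 1 ≤ k ∧ k ≤ n ∧ k ≤ dimdelta (k * ε - ε / 2) (mapLat a (latticeOf g)) ∧
      dimdelta (k * ε + ε / 2) (mapLat a (latticeOf g)) ≤ k := by
  classical
  set P : ℕ → Prop := fun k => k ≤ dimdelta (k * ε - ε / 2) (mapLat a (latticeOf g)) with hP
  have hag : IsUnit (a * g).det := by
    rw [det_mul]
    exact (isUnit_det_of_mem_Apos ha).mul hg
  have hP1 : P 1 := by
    simp only [hP, mapLat_latticeOf]
    refine one_le_dimdelta hn hag ?_
    push_cast
    linarith
  have hPn : ∀ k, P k → k ≤ n := fun k hk => le_trans hk (dimdelta_le _ _)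
  refine ⟨Nat.findGreatest P n, Nat.le_findGreatest hn hP1, Nat.findGreatest_le n,
    Nat.findGreatest_spec hn hP1, ?_⟩
  have hnot : ¬ P (Nat.findGreatest P n + 1) := fun h =>
    absurd (Nat.le_findGreatest (hPn _ h) h) (by omega)
  simp only [hP, not_le] at hnot
  refine le_trans (dimdelta_mono hn hg ha ?_) (Nat.lt_succ_iff.mp hnot)
  push_cast
  linarith

lemma continuous_enorm_logCoord_sub {n : ℕ} (v : Fin n → ℝ) :
    Continuous fun a : ↥(Apos n) => enorm (logCoord (a : Matrix (Fin n) (Fin n) ℝ) - v) := by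
  unfold enorm
  refine Real.continuous_sqrt.comp (continuous_finsetSum _ fun i _ => ?_)
  refine ((Continuous.log ?_ ?_).sub continuous_const).pow 2
  · exact (continuous_subtype_val.matrix_elem i i)
  · rintro ⟨_, d, hd, -, rfl⟩
    simpa using (hd i).ne'

lemma isOpen_Uset {n : ℕ} (hn : 0 < n) {g : Matrix (Fin n) (Fin n) ℝ} (hg : IsUnit g.det)
    {ε : ℝ} (hε : 0 < ε) {k : ℕ} (hk : k ≤ n) :
    IsOpen {a : ↥(Apos n) | (a : Matrix (Fin n) (Fin n) ℝ) ∈ Uset (latticeOf g) ε k} := by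
  rw [isOpen_iff_mem_nhds]
  rintro a ⟨ha, t, ht, hdim⟩
  obtain ⟨s, hs, hst⟩ := Metric.nhds_basis_closedBall.mem_iff.mp ht
  obtain ⟨r, hr, hball⟩ := exists_radius hn hg hε hs
  have hmem : ∀ δ : ℝ, |δ - k * ε| ≤ s → dimdelta δ (mapLat a (latticeOf g)) = k := fun δ hδ =>
    hdim δ (hst (by rwa [Metric.mem_closedBall, Real.dist_eq]))
  have hlow := hmem (k * ε - s) (by rw [sub_sub_cancel_left, abs_neg, abs_of_pos hs])
  have hup := hmem (k * ε + s) (by rw [add_sub_cancel_left, abs_of_pos hs])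
  have hnhds := (isOpen_Iio (a := r)).preimage
    (continuous_enorm_logCoord_sub (logCoord (a : Matrix (Fin n) (Fin n) ℝ)))
  refine mem_of_superset (hnhds.mem_nhds ?_)
    fun a' ha' => hball k hk a ha hlow.ge hup.le a' a'.2 ha'
  rw [Set.mem_preimage, sub_self, enorm_zero]
  exact hr

end SW

/-- **Lemma 3.4.** For `x ∈ ℒ_n` with bounded `A`-orbit and `ε ∈ (0,1)`, the sets `U_k^{x,ε}`,
`1 ≤ k ≤ n`, form an open cover of `A` with positive inradius (in the logarithmic coordinates
on `A`). -/
theorem SW.Uk_open_cover_positive_inradius (n : ℕ) (hn : 0 < n)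
    (g : Matrix (Fin n) (Fin n) ℝ) (hg : g.det = 1) (hb : SW.HasBoundedAOrbit g)
    (ε : ℝ) (hε : ε ∈ Set.Ioo (0 : ℝ) 1) :
    (∀ k : ℕ, 1 ≤ k → k ≤ n →
      IsOpen {a : ↥(SW.Apos n) | (a : Matrix (Fin n) (Fin n) ℝ) ∈ SW.Uset (SW.latticeOf g) ε k}) ∧
    (∀ a ∈ SW.Apos n, ∃ k : ℕ, 1 ≤ k ∧ k ≤ n ∧ a ∈ SW.Uset (SW.latticeOf g) ε k) ∧
    ∃ r : ℝ, 0 < r ∧ ∀ a ∈ SW.Apos n, ∃ k : ℕ, 1 ≤ k ∧ k ≤ n ∧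
      ∀ a' ∈ SW.Apos n, SW.enorm (SW.logCoord a' - SW.logCoord a) < r →
        a' ∈ SW.Uset (SW.latticeOf g) ε k := by
  have hgu : IsUnit g.det := hg ▸ isUnit_one
  obtain ⟨r, hr, hball⟩ := SW.exists_radius hn hgu hε.1 (half_pos hε.1)
  have hinradius : ∀ a ∈ SW.Apos n, ∃ k : ℕ, 1 ≤ k ∧ k ≤ n ∧
      ∀ a' ∈ SW.Apos n, SW.enorm (SW.logCoord a' - SW.logCoord a) < r →
        a' ∈ SW.Uset (SW.latticeOf g) ε k := fun a ha => by
    obtain ⟨k, h1, hkn, hlow, hup⟩ := SW.exists_index hn hgu hε.1 ha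
    exact ⟨k, h1, hkn, hball k hkn a ha hlow hup⟩
  refine ⟨fun k _ hk => SW.isOpen_Uset hn hgu hε.1 hk, fun a ha => ?_, r, hr, hinradius⟩
  obtain ⟨k, h1, hkn, hU⟩ := hinradius a ha
  exact ⟨k, h1, hkn, hU a ha (by rwa [sub_self, SW.enorm_zero])⟩
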